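/- Let 1<p,q<∞, let σ, w be Radon measures on ℝ^N, and let b={b_Q}_{Q∈𝒟} be real coefficients. If 1<p≤2≤q<∞, then the quadratic 𝒜^b_{p,q}-condition is equivalent to the pointwise condition sup_{Q∈𝒟} |b_Q|·σ(Q)^{1/p′} w(Q)^{1/q}/|Q| < ∞; in fact [σ,w]^b_{p,q} = sup_{Q∈𝒟} |b_Q|·σ(Q)^{1/p′} w(Q)^{1/q}/|Q|. -/

import Mathlib

open MeasureTheory ENNReal Set

noncomputable section

abbrev EucN (N : ℕ) := Fin N → ℝ

/-- The half-open cube `x + [0, 2^{-k})^N`. -/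
def dyCube (N : ℕ) (k : ℤ) (x : EucN N) : Set (EucN N) :=
  {y | ∀ i, x i ≤ y i ∧ y i < x i + (2 : ℝ) ^ (-k)}

/-- A dyadic lattice on `ℝ^N`: for every `k ∈ ℤ`, `gen k` is a partition of `ℝ^N` into
half-open cubes of side `2^{-k}`, and the generations are nested. -/
structure DyadicLattice (N : ℕ) where
  gen : ℤ → Set (Set (EucN N))
  cube_form : ∀ k Q, Q ∈ gen k → ∃ x, Q = dyCube N k x
  covers : ∀ k (y : EucN N), ∃ Q ∈ gen k, y ∈ Q
  pairwiseDisjoint : ∀ k, (gen k).PairwiseDisjoint id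
  nested : ∀ k, ∀ Q ∈ gen (k + 1), ∃ R ∈ gen k, Q ⊆ R

namespace DyadicLattice
variable {N : ℕ}
/-- The collection `𝒟` of all dyadic cubes. -/
def cubes (D : DyadicLattice N) : Set (Set (EucN N)) := ⋃ k, D.gen k
/-- `Q'` is a dyadic child of `Q`. -/
def child (D : DyadicLattice N) (Q Q' : Set (EucN N)) : Prop :=
  ∃ k, Q ∈ D.gen k ∧ Q' ∈ D.gen (k + 1) ∧ Q' ⊆ Q
/-- `R = Q^{(r)}` is the `r`-th dyadic ancestor of `Q`. -/
def anc (D : DyadicLattice N) (r : ℕ) (Q R : Set (EucN N)) : Prop :=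
  ∃ k : ℤ, Q ∈ D.gen k ∧ R ∈ D.gen (k - r) ∧ Q ⊆ R
end DyadicLattice

/-- `ℝ≥0∞`-valued indicator of a set. -/
def indE {N : ℕ} (Q : Set (EucN N)) (x : EucN N) : ℝ≥0∞ := Q.indicator 1 x

/-- `‖ (∑ i (f i)²)^{1/2} ‖_{L^p(μ)}` for a family of `ℝ≥0∞`-valued functions. -/
def sqNorm {N : ℕ} {ι : Type*} (μ : Measure (EucN N)) (p : ℝ)
    (f : ι → EucN N → ℝ≥0∞) : ℝ≥0∞ :=
  (∫⁻ x, (∑' i, f i x ^ 2) ^ (p / 2) ∂μ) ^ (1 / p)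

/-- The quadratic `𝒜_{p,q}` constant `[σ,w]_{p,q}`: the least `C` such that for all real
coefficients `(a_Q)_{Q ∈ 𝒟}`,
`‖(∑_Q (a_Q σ(Q)/|Q|)² 1_Q)^{1/2}‖_{L^q(w)} ≤ C ‖(∑_Q a_Q² 1_Q)^{1/2}‖_{L^p(σ)}`. -/
def sqA {N : ℕ} (D : DyadicLattice N) (σ w : Measure (EucN N)) (p q : ℝ) : ℝ≥0∞ :=
  sInf {C | ∀ a : Set (EucN N) → ℝ,
    sqNorm w q (fun Q : D.cubes => fun x =>
      (‖a (Q : Set (EucN N))‖₊ : ℝ≥0∞) * σ (Q : Set (EucN N)) / volume (Q : Set (EucN N))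
        * indE (Q : Set (EucN N)) x)
    ≤ C * sqNorm σ p (fun Q : D.cubes => fun x =>
      (‖a (Q : Set (EucN N))‖₊ : ℝ≥0∞) * indE (Q : Set (EucN N)) x)}

/-- The quadratic `𝒜^b_{p,q}` constant `[σ,w]^b_{p,q}`: the least `C` with
`‖(∑_Q (a_Q b_Q σ(Q)/|Q|)² 1_Q)^{1/2}‖_{L^q(w)} ≤ C ‖(∑_Q a_Q² 1_Q)^{1/2}‖_{L^p(σ)}`
for all real coefficients `(a_Q)_{Q ∈ 𝒟}`. -/
def sqAb {N : ℕ} (D : DyadicLattice N) (σ w : Measure (EucN N))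
    (b : Set (EucN N) → ℝ) (p q : ℝ) : ℝ≥0∞ :=
  sInf {C | ∀ a : Set (EucN N) → ℝ,
    sqNorm w q (fun Q : D.cubes => fun x =>
      (‖a (Q : Set (EucN N)) * b (Q : Set (EucN N))‖₊ : ℝ≥0∞) * σ (Q : Set (EucN N))
        / volume (Q : Set (EucN N)) * indE (Q : Set (EucN N)) x)
    ≤ C * sqNorm σ p (fun Q : D.cubes => fun x =>
      (‖a (Q : Set (EucN N))‖₊ : ℝ≥0∞) * indE (Q : Set (EucN N)) x)}

namespace ENNReal

/-- Minkowski's inequality for countable sums in `L^r`, `1 ≤ r < ∞`. -/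
theorem lintegral_rpow_tsum_le {α ι : Type*} [MeasurableSpace α] [Countable ι] {μ : Measure α}
    {r : ℝ} (hr : 1 ≤ r) {h : ι → α → ℝ≥0∞} (hh : ∀ i, Measurable (h i)) :
    (∫⁻ x, (∑' i, h i x) ^ r ∂μ) ^ (1 / r) ≤ ∑' i, (∫⁻ x, h i x ^ r ∂μ) ^ (1 / r) := by
  classical
  have hr0 : 0 < r := by linarith
  have finite_case (s : Finset ι) :
      (∫⁻ x, (∑ i ∈ s, h i x) ^ r ∂μ) ^ (1 / r) ≤ ∑ i ∈ s, (∫⁻ x, h i x ^ r ∂μ) ^ (1 / r) := by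
    induction s using Finset.induction_on with
    | empty => simp [hr0]
    | insert i s hi ih =>
      simp only [Finset.sum_insert hi]
      exact (lintegral_Lp_add_le (hh i).aemeasurable
        (Finset.measurable_fun_sum s fun i _ => hh i).aemeasurable hr).trans (by gcongr)
  have sup_eq : ∫⁻ x, (∑' i, h i x) ^ r ∂μ
      = ⨆ s : Finset ι, ∫⁻ x, (∑ i ∈ s, h i x) ^ r ∂μ := by
    rw [← lintegral_iSup_directed]
    · refine lintegral_congr fun x => ?_
      rw [ENNReal.tsum_eq_iSup_sum]
      exact (orderIsoRpow r hr0).map_iSup _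
    · exact fun s => ((Finset.measurable_fun_sum s fun i _ => hh i).pow_const r).aemeasurable
    · refine Monotone.directed_le fun s t hst x => ?_
      exact rpow_le_rpow (Finset.sum_le_sum_of_subset hst) hr0.le
  rw [sup_eq]
  refine ((orderIsoRpow (1 / r) (by positivity)).map_iSup _).trans_le (iSup_le fun s => ?_)
  exact (finite_case s).trans (ENNReal.sum_le_tsum s)

/-- The reverse Minkowski inequality in `L^r`, `0 < r ≤ 1`. -/
theorem tsum_lintegral_rpow_le {α ι : Type*} [MeasurableSpace α] {μ : Measure α}
    {r : ℝ} (hr0 : 0 < r) (hr : r ≤ 1) {h : ι → α → ℝ≥0∞} (hh : ∀ i, Measurable (h i)) :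
    ∑' i, (∫⁻ x, h i x ^ r ∂μ) ^ (1 / r) ≤ (∫⁻ x, (∑' i, h i x) ^ r ∂μ) ^ (1 / r) := by
  rw [ENNReal.tsum_eq_iSup_sum]
  refine iSup_le fun s => le_trans ?_ (rpow_le_rpow (lintegral_mono fun x =>
    rpow_le_rpow (ENNReal.sum_le_tsum s) hr0.le) (by positivity))
  obtain rfl | hr1 := hr.eq_or_lt
  · simp only [div_one, rpow_one]
    rw [lintegral_finsetSum _ fun i _ => hh i]
  set I := ∫⁻ x, (∑ i ∈ s, h i x) ^ r ∂μ with hI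
  set A : ι → ℝ≥0∞ := fun i => ∫⁻ x, h i x ^ r ∂μ with hA
  obtain hItop | hItop := eq_or_ne I ∞
  · simp [hItop, hr0]
  have hAI : ∀ i ∈ s, A i ≤ I := fun i hi => lintegral_mono fun x =>
    rpow_le_rpow (Finset.single_le_sum (f := fun i => h i x) (fun _ _ => zero_le) hi) hr0.le
  have ht1 : 1 < 1 / r := (one_lt_div hr0).2 hr1
  have hconj := (Real.HolderConjugate.conjExponent ht1).symm
  set t := 1 / r with ht
  set u := Real.conjExponent t
  have ht0 : 0 < t := by positivity
  set T := ∑ i ∈ s, A i ^ t with hT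
  change T ≤ I ^ t
  have hTtop : T ≠ ∞ := by
    refine (sum_lt_top.2 fun i hi => ?_).ne
    exact rpow_lt_top_of_nonneg ht0.le ((hAI i hi).trans_lt hItop.lt_top).ne
  obtain hT0 | hT0 := eq_or_ne T 0
  · simp [hT0]
  have holder : T ≤ T ^ (1 / u) * I := calc
    T = ∑ i ∈ s, A i ^ (t - 1) * A i := by
      refine Finset.sum_congr rfl fun i _ => ?_
      conv_rhs => rw [← rpow_one (A i), ← rpow_mul, one_mul,
        ← rpow_add_of_nonneg _ _ (by linarith) zero_le_one]
      simp
    _ = ∫⁻ x, ∑ i ∈ s, A i ^ (t - 1) * h i x ^ r ∂μ := by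
      rw [lintegral_finsetSum _ fun i _ => ((hh i).pow_const r).const_mul _]
      refine Finset.sum_congr rfl fun i _ => ?_
      rw [lintegral_const_mul _ ((hh i).pow_const r)]
    _ ≤ ∫⁻ x, T ^ (1 / u) * (∑ i ∈ s, h i x) ^ r ∂μ := by
      refine lintegral_mono fun x => (inner_le_Lp_mul_Lq s _ _ hconj).trans_eq ?_
      congr 2
      · refine Finset.sum_congr rfl fun i _ => ?_
        rw [← rpow_mul, hconj.symm.sub_one_mul_conj]
      · refine Finset.sum_congr rfl fun i _ => ?_
        rw [← rpow_mul, ht, mul_one_div_cancel hr0.ne', rpow_one]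
      · rw [ht, one_div_one_div]
    _ = T ^ (1 / u) * I :=
      lintegral_const_mul _ ((Finset.measurable_fun_sum s fun i _ => hh i).pow_const r)
  have split : T = T ^ (1 / u) * T ^ (1 / t) := by
    rw [← rpow_add _ _ hT0 hTtop, one_div, one_div, hconj.inv_add_inv_eq_one, rpow_one]
  have key : T ^ (1 / t) ≤ I := by
    have hu0 : T ^ (1 / u) ≠ 0 := (rpow_pos (pos_iff_ne_zero.2 hT0) hTtop).ne'
    have hutop : T ^ (1 / u) ≠ ∞ :=
      rpow_ne_top_of_nonneg (one_div_nonneg.2 hconj.nonneg) hTtop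
    refine (ENNReal.mul_le_mul_iff_right hu0 hutop).1 ?_
    rwa [← split]
  calc T = (T ^ (1 / t)) ^ t := by rw [← rpow_mul, one_div_mul_cancel ht0.ne', rpow_one]
    _ ≤ I ^ t := rpow_le_rpow key ht0.le

end ENNReal

section DyadicCubes
variable {N : ℕ}

theorem dyCube_eq_pi (k : ℤ) (x : EucN N) :
    dyCube N k x = univ.pi fun i => Ico (x i) (x i + (2 : ℝ) ^ (-k)) := by
  ext y
  simp [dyCube, Set.mem_pi]

theorem measurableSet_dyCube (k : ℤ) (x : EucN N) : MeasurableSet (dyCube N k x) := by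
  rw [dyCube_eq_pi]
  exact MeasurableSet.univ_pi fun _ => measurableSet_Ico

theorem measure_dyCube_lt_top (μ : Measure (EucN N)) [IsLocallyFiniteMeasure μ] (k : ℤ)
    (x : EucN N) : μ (dyCube N k x) < ∞ := by
  refine (measure_mono ?_).trans_lt
    (isCompact_univ_pi fun i => isCompact_Icc (a := x i) (b := x i + (2 : ℝ) ^ (-k))).measure_lt_top
  rw [dyCube_eq_pi]
  exact pi_mono fun _ _ => Ico_subset_Icc_self

theorem nonempty_interior_dyCube (k : ℤ) (x : EucN N) : (interior (dyCube N k x)).Nonempty := by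
  rw [dyCube_eq_pi, interior_pi_set finite_univ]
  simp only [interior_Ico, univ_pi_nonempty_iff, nonempty_Ioo]
  exact fun i => lt_add_of_pos_right _ (by positivity)

namespace DyadicLattice
variable {D : DyadicLattice N} {Q : Set (EucN N)}

theorem exists_eq_dyCube (hQ : Q ∈ D.cubes) : ∃ k x, Q = dyCube N k x := by
  obtain ⟨k, hk⟩ := mem_iUnion.1 hQ
  exact ⟨k, D.cube_form k Q hk⟩

theorem measurableSet (hQ : Q ∈ D.cubes) : MeasurableSet Q := by
  obtain ⟨k, x, rfl⟩ := exists_eq_dyCube hQ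
  exact measurableSet_dyCube k x

theorem measure_ne_top (μ : Measure (EucN N)) [IsLocallyFiniteMeasure μ] (hQ : Q ∈ D.cubes) :
    μ Q ≠ ∞ := by
  obtain ⟨k, x, rfl⟩ := exists_eq_dyCube hQ
  exact (measure_dyCube_lt_top μ k x).ne

theorem countable_cubes (D : DyadicLattice N) : D.cubes.Countable := by
  refine countable_iUnion fun k =>
    (D.pairwiseDisjoint k).countable_of_nonempty_interior fun Q hQ => ?_
  obtain ⟨x, rfl⟩ := D.cube_form k Q hQ
  exact nonempty_interior_dyCube k x

end DyadicLattice
end DyadicCubes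

section SquareFunctions
variable {N : ℕ}

theorem measurable_indE {Q : Set (EucN N)} (hQ : MeasurableSet Q) : Measurable (indE Q) :=
  measurable_one.indicator hQ

theorem lintegral_mul_indE_rpow (μ : Measure (EucN N)) {p : ℝ} (hp : 0 < p) (c : ℝ≥0∞)
    {Q : Set (EucN N)} (hQ : MeasurableSet Q) :
    (∫⁻ x, ((c * indE Q x) ^ 2) ^ (p / 2) ∂μ) ^ (1 / (p / 2)) = (c * μ Q ^ (1 / p)) ^ 2 := by
  have hpow (x : EucN N) : ((c * indE Q x) ^ 2) ^ (p / 2) = Q.indicator (fun _ => c ^ p) x := by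
    rw [← rpow_natCast, ← rpow_mul, Nat.cast_ofNat, mul_div_cancel₀ _ (two_ne_zero' ℝ)]
    by_cases hx : x ∈ Q <;> simp [indE, hx, hp]
  simp_rw [hpow]
  rw [lintegral_indicator_const hQ, ← rpow_natCast, mul_rpow_of_nonneg _ _ (by positivity),
    mul_rpow_of_nonneg _ _ (by positivity), ← rpow_mul, ← rpow_mul]
  congr 2 <;> push_cast <;> field_simp

theorem sqNorm_eq_rpow {ι : Type*} (μ : Measure (EucN N)) {p : ℝ} (hp : 0 < p)
    (f : ι → EucN N → ℝ≥0∞) :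
    sqNorm μ p f
      = ((∫⁻ x, (∑' i, f i x ^ 2) ^ (p / 2) ∂μ) ^ (1 / (p / 2))) ^ (1 / 2 : ℝ) := by
  rw [sqNorm, ← rpow_mul]
  congr 1
  field_simp

theorem sqNorm_indE_le {ι : Type*} [Countable ι] (μ : Measure (EucN N)) {q : ℝ} (hq : 2 ≤ q)
    (c : ι → ℝ≥0∞) {Q : ι → Set (EucN N)} (hQ : ∀ i, MeasurableSet (Q i)) :
    sqNorm μ q (fun i x => c i * indE (Q i) x)
      ≤ (∑' i, (c i * μ (Q i) ^ (1 / q)) ^ 2) ^ (1 / 2 : ℝ) := by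
  have hq0 : 0 < q := by linarith
  rw [sqNorm_eq_rpow μ hq0]
  refine rpow_le_rpow ((lintegral_rpow_tsum_le (by linarith)
    fun i => ((measurable_indE (hQ i)).const_mul _).pow_const 2).trans_eq ?_) (by norm_num)
  exact tsum_congr fun i => lintegral_mul_indE_rpow μ hq0 (c i) (hQ i)

theorem le_sqNorm_indE {ι : Type*} (μ : Measure (EucN N)) {p : ℝ} (hp0 : 0 < p) (hp : p ≤ 2)
    (c : ι → ℝ≥0∞) {Q : ι → Set (EucN N)} (hQ : ∀ i, MeasurableSet (Q i)) :
    (∑' i, (c i * μ (Q i) ^ (1 / p)) ^ 2) ^ (1 / 2 : ℝ)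
      ≤ sqNorm μ p (fun i x => c i * indE (Q i) x) := by
  rw [sqNorm_eq_rpow μ hp0]
  refine rpow_le_rpow (le_trans (Eq.le ?_) (tsum_lintegral_rpow_le (by positivity) (by linarith)
    fun i => ((measurable_indE (hQ i)).const_mul _).pow_const 2)) (by norm_num)
  exact tsum_congr fun i => (lintegral_mul_indE_rpow μ hp0 (c i) (hQ i)).symm

theorem sqNorm_indE_of_unique_support {ι : Type*} (μ : Measure (EucN N)) {p : ℝ} (hp : 0 < p)
    (c : ι → ℝ≥0∞) {Q : ι → Set (EucN N)} (i : ι) (hQ : MeasurableSet (Q i))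
    (hc : ∀ j, j ≠ i → c j = 0) :
    sqNorm μ p (fun i x => c i * indE (Q i) x) = c i * μ (Q i) ^ (1 / p) := by
  have hsum (x : EucN N) : ∑' j, (c j * indE (Q j) x) ^ 2 = (c i * indE (Q i) x) ^ 2 :=
    tsum_eq_single i fun j hj => by simp [hc j hj]
  rw [sqNorm_eq_rpow μ hp]
  simp_rw [hsum]
  rw [lintegral_mul_indE_rpow μ hp (c i) hQ, ← rpow_natCast, ← rpow_mul]
  norm_num

end SquareFunctions

/-- If `1 < p ≤ 2 ≤ q < ∞`, then the quadratic `𝒜^b_{p,q}` constant equals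
`sup_{Q ∈ 𝒟} |b_Q| σ(Q)^{1/p'} w(Q)^{1/q} / |Q|`. -/
theorem quadratic_Apq_b_eq_sup (N : ℕ) (hN : 1 ≤ N) (p q : ℝ) (hp : 1 < p) (hp2 : p ≤ 2)
    (hq2 : 2 ≤ q) (D : DyadicLattice N) (σ w : Measure (EucN N))
    (hσ : IsLocallyFiniteMeasure σ) (hw : IsLocallyFiniteMeasure w)
    (b : Set (EucN N) → ℝ) :
    sqAb D σ w b p q =
      ⨆ Q ∈ D.cubes, (‖b Q‖₊ : ℝ≥0∞) * σ Q ^ (1 - 1 / p) * w Q ^ (1 / q) / volume Q := by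
  classical
  have hp0 : 0 < p := by linarith
  have hq0 : 0 < q := by linarith
  have hp' : 0 < 1 - 1 / p := sub_pos.2 ((div_lt_one hp0).2 hp)
  have hmeas (Q : D.cubes) : MeasurableSet (Q : Set (EucN N)) := DyadicLattice.measurableSet Q.2
  have hσtop (Q : D.cubes) : σ Q ≠ ∞ := DyadicLattice.measure_ne_top σ Q.2
  have : Countable D.cubes := D.countable_cubes.to_subtype
  have hsplit (Q : D.cubes) : σ Q = σ Q ^ (1 - 1 / p) * σ Q ^ (1 / p) := by
    rw [← rpow_add_of_nonneg _ _ hp'.le (by positivity), sub_add_cancel, rpow_one]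
  apply le_antisymm
  · set S := ⨆ Q ∈ D.cubes, (‖b Q‖₊ : ℝ≥0∞) * σ Q ^ (1 - 1 / p) * w Q ^ (1 / q) / volume Q
    refine sInf_le fun a => (sqNorm_indE_le w hq2 _ hmeas).trans ?_
    refine le_trans ?_ (mul_le_mul_right (le_sqNorm_indE σ hp0 hp2 _ hmeas) S)
    have hS : S = (S ^ 2) ^ (1 / 2 : ℝ) := by
      rw [← rpow_natCast, ← rpow_mul]
      norm_num
    rw [hS, ← mul_rpow_of_nonneg _ _ (by norm_num), ← ENNReal.tsum_mul_left]
    refine rpow_le_rpow (ENNReal.tsum_le_tsum fun Q => ?_) (by norm_num)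
    rw [← mul_pow]
    refine pow_le_pow_left₀ zero_le ?_ 2
    calc (‖a Q * b Q‖₊ : ℝ≥0∞) * σ Q / volume (Q : Set (EucN N)) * w Q ^ (1 / q)
        = (‖b Q‖₊ * σ Q ^ (1 - 1 / p) * w Q ^ (1 / q) / volume (Q : Set (EucN N)))
            * (‖a Q‖₊ * σ Q ^ (1 / p)) := by
          rw [nnnorm_mul, coe_mul]
          conv_lhs => rw [hsplit Q]
          simp only [div_eq_mul_inv]
          ring
      _ ≤ S * (‖a Q‖₊ * σ Q ^ (1 / p)) := by
          gcongr
          exact le_iSup₂_of_le (Q : Set (EucN N)) Q.2 le_rfl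
  · refine le_sInf fun C hC => iSup₂_le fun R hR => ?_
    lift R to D.cubes using hR
    obtain h0 | h0 := eq_or_ne (σ R) 0
    · rw [h0, zero_rpow_of_pos hp']
      simp
    have test := hC (Pi.single (R : Set (EucN N)) 1)
    have hne (Q : D.cubes) (hQ : Q ≠ R) : (Q : Set (EucN N)) ≠ R := Subtype.coe_injective.ne hQ
    rw [sqNorm_indE_of_unique_support w hq0 _ R (hmeas R) fun Q hQ => by simp [hne Q hQ],
      sqNorm_indE_of_unique_support σ hp0 _ R (hmeas R) fun Q hQ => by simp [hne Q hQ]] at test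
    simp only [Pi.single_eq_same, one_mul, nnnorm_one, coe_one] at test
    have hc0 : σ R ^ (1 / p) ≠ 0 := (rpow_pos (pos_iff_ne_zero.2 h0) (hσtop R)).ne'
    have hctop : σ R ^ (1 / p) ≠ ∞ := rpow_ne_top_of_nonneg (by positivity) (hσtop R)
    refine (ENNReal.mul_le_mul_iff_left hc0 hctop).1 (le_trans (Eq.le ?_) test)
    conv_rhs => rw [hsplit R]
    simp only [div_eq_mul_inv]
    ring

end
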